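/- arXiv:1810.11410 — 2 statements merged into one kernel-verified Lean document; each statement's English description precedes it below -/
import Mathlib

section
/- Abelianity condition, case |m|, |n| > 1: let m, n ∈ ℤ with |m| > 1 and |n| > 1, and let λ, λ' ∈ ℤ ∖ {0} with λ + λ' = 1. Set s = q^{−Nλ/m} and s* = q^{−Nλ'/n} (real rational powers of q). Then: (i) the surface condition holds, s^m (s*)^n = q^{−N}; (ii) with c = N(λ'm − λn)/(nm) one has (s*)² = s² q^{−2c}; and (iii) for every x ∈ ℂ with x ≠ 0 and x² ∉ {q^t : t ∈ ℚ} (so that no theta factor vanishes), the structure function equals one: 𝒴_{m,n}(x) := ℱ_n(x;s*) ℱ_{−n}(x;s*) / (ℱ_m(x;s) ℱ_{−m}(x;s)) = 1. -/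
open Complex

noncomputable section

/-- single infinite Pochhammer symbol `(x;s)_∞`. -/
def poch1 (x s : ℂ) : ℂ := ∏' n : ℕ, (1 - x * s ^ n)

/-- Jacobi `Θ_s(x)` function. -/
def ThetaF (s x : ℂ) : ℂ := poch1 x s * poch1 (s * x⁻¹) s * poch1 s s

/-- the function `𝒰(x) = q^{2/N-2} Θ_{q^{2N}}(q²x²) Θ_{q^{2N}}(q²x⁻²) /
(Θ_{q^{2N}}(x²) Θ_{q^{2N}}(x⁻²))` for a real number `q ∈ (0,1)`. -/
def Ureal (N : ℕ) (q : ℝ) (x : ℂ) : ℂ :=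
  ((q ^ ((2 : ℝ) / N - 2) : ℝ) : ℂ) * ThetaF ((q : ℂ) ^ (2 * N)) ((q : ℂ) ^ 2 * x ^ 2) *
    ThetaF ((q : ℂ) ^ (2 * N)) ((q : ℂ) ^ 2 * (x⁻¹) ^ 2) /
    (ThetaF ((q : ℂ) ^ (2 * N)) (x ^ 2) * ThetaF ((q : ℂ) ^ (2 * N)) ((x⁻¹) ^ 2))

/-- the function `ℱ_a(x;s)`. -/
def Fa (N : ℕ) (q : ℝ) (a : ℤ) (x s : ℂ) : ℂ :=
  if 0 < a then ∏ ℓ ∈ Finset.range a.toNat, Ureal N q (s ^ ℓ * x)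
  else ∏ ℓ ∈ Finset.Icc 1 a.natAbs, (Ureal N q ((s ^ ℓ)⁻¹ * x))⁻¹

/-- `y` is nonzero and not a rational power of `q`. -/
def Gen (q : ℝ) (y : ℂ) : Prop := y ≠ 0 ∧ ∀ t : ℚ, y ≠ ((q ^ (t : ℝ) : ℝ) : ℂ)

lemma Gen.mul {q : ℝ} (hq0 : 0 < q) {y : ℂ} (h : Gen q y) (r : ℚ) :
    Gen q (((q ^ (r : ℝ) : ℝ) : ℂ) * y) := by
  have hp : 0 < q ^ (r : ℝ) := Real.rpow_pos_of_pos hq0 _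
  have hp' : ((q ^ (r : ℝ) : ℝ) : ℂ) ≠ 0 := by exact_mod_cast hp.ne'
  refine ⟨mul_ne_zero hp' h.1, fun t ht => h.2 (t - r) ?_⟩
  have : q ^ (((t - r : ℚ)) : ℝ) = q ^ (t : ℝ) / q ^ (r : ℝ) := by
    push_cast; rw [Real.rpow_sub hq0]
  rw [this]; push_cast; rw [← ht]; field_simp

lemma Gen.inv {q : ℝ} (hq0 : 0 < q) {y : ℂ} (h : Gen q y) : Gen q y⁻¹ := by
  refine ⟨inv_ne_zero h.1, fun t ht => h.2 (-t) ?_⟩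
  push_cast
  rw [Real.rpow_neg hq0.le]; push_cast; rw [← ht, inv_inv]

lemma Gen.mul_pow {q : ℝ} (hq0 : 0 < q) {y : ℂ} (h : Gen q y) (k : ℕ) :
    Gen q ((q : ℂ) ^ k * y) := by
  have := h.mul hq0 (k : ℚ)
  simpa using this

lemma Gen.ne_one {q : ℝ} {y : ℂ} (h : Gen q y) : y ≠ 1 := by
  have := h.2 0
  simpa using this

lemma summ (x s : ℂ) (hs : ‖s‖ < 1) : Summable (fun n : ℕ => ‖-(x * s ^ n)‖) := by
  simp only [norm_neg, norm_mul, norm_pow]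
  exact (summable_geometric_of_lt_one (norm_nonneg _) hs).mul_left _

lemma mult (x s : ℂ) (hs : ‖s‖ < 1) : Multipliable (fun n : ℕ => (1 - x * s ^ n)) := by
  have := multipliable_one_add_of_summable (summ x s hs)
  simpa [sub_eq_add_neg] using this

lemma poch_ne (x s : ℂ) (hs : ‖s‖ < 1) (h : ∀ n : ℕ, 1 - x * s ^ n ≠ 0) : poch1 x s ≠ 0 := by
  have := tprod_one_add_ne_zero_of_summable (f := fun n : ℕ => -(x * s ^ n))
    (fun n => by simpa [sub_eq_add_neg] using h n) (summ x s hs)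
  simpa [poch1, sub_eq_add_neg] using this

lemma poch_shift (x s : ℂ) (hs : ‖s‖ < 1) : poch1 x s = (1 - x) * poch1 (s * x) s := by
  have h2 : (fun n : ℕ => (1 - x * s ^ (n + 1))) = fun n : ℕ => 1 - (s * x) * s ^ n := by
    funext n; ring
  have h3 := tprod_eq_zero_mul' (f := fun n : ℕ => (1 - x * s ^ n))
    (by rw [h2]; exact mult _ _ hs)
  rw [h2] at h3
  simpa [poch1] using h3

lemma theta_shift (s x : ℂ) (hs : ‖s‖ < 1) (hs0 : s ≠ 0) (hx : x ≠ 0) (hx1 : x ≠ 1) :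
    ThetaF s (s * x) = -x⁻¹ * ThetaF s x := by
  have h1 := poch_shift x s hs
  have h2 := poch_shift x⁻¹ s hs
  have h3 : s * (s * x)⁻¹ = x⁻¹ := by field_simp
  unfold ThetaF
  rw [h3, h1, h2]
  field_simp
  ring

lemma normQ {N : ℕ} (hN : 2 ≤ N) {q : ℝ} (hq0 : 0 < q) (hq1 : q < 1) :
    ‖(q : ℂ) ^ (2 * N)‖ < 1 := by
  rw [norm_pow, Complex.norm_real, Real.norm_of_nonneg hq0.le]
  exact pow_lt_one₀ hq0.le hq1 (by omega)

lemma theta_ne {N : ℕ} (hN : 2 ≤ N) {q : ℝ} (hq0 : 0 < q) (hq1 : q < 1) {y : ℂ}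
    (h : Gen q y) : ThetaF ((q : ℂ) ^ (2 * N)) y ≠ 0 := by
  have hQ := normQ hN hq0 hq1
  have key : ∀ z, Gen q z → poch1 z ((q : ℂ) ^ (2 * N)) ≠ 0 := by
    intro z hz
    refine poch_ne _ _ hQ fun n hn => ?_
    have := (hz.mul_pow hq0 (2 * N * n)).ne_one
    apply this
    rw [pow_mul]
    linear_combination -hn
  refine mul_ne_zero (mul_ne_zero (key _ h) (key _ ((h.inv hq0).mul_pow hq0 _))) ?_
  refine poch_ne _ _ hQ fun n hn => ?_
  have h1 : (q : ℂ) ^ (2 * N) * ((q : ℂ) ^ (2 * N)) ^ n = 1 := by linear_combination -hn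
  have h2 : q ^ (2 * N * (n + 1)) = 1 := by
    rw [pow_mul, pow_succ']; exact_mod_cast h1
  have h3 : q ^ (2 * N * (n + 1)) < 1 := pow_lt_one₀ hq0.le hq1 (by positivity)
  exact h3.ne h2

lemma U_ne {N : ℕ} (hN : 2 ≤ N) {q : ℝ} (hq0 : 0 < q) (hq1 : q < 1) {x : ℂ}
    (h : Gen q (x ^ 2)) : Ureal N q x ≠ 0 := by
  have hi : Gen q ((x⁻¹) ^ 2) := by rw [inv_pow]; exact h.inv hq0
  have hp : ((q ^ ((2 : ℝ) / N - 2) : ℝ) : ℂ) ≠ 0 := by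
    exact_mod_cast (Real.rpow_pos_of_pos hq0 _).ne'
  exact div_ne_zero (mul_ne_zero (mul_ne_zero hp (theta_ne hN hq0 hq1 (h.mul_pow hq0 2)))
    (theta_ne hN hq0 hq1 (hi.mul_pow hq0 2)))
    (mul_ne_zero (theta_ne hN hq0 hq1 h) (theta_ne hN hq0 hq1 hi))

lemma U_shift {N : ℕ} (hN : 2 ≤ N) {q : ℝ} (hq0 : 0 < q) (hq1 : q < 1) {x : ℂ}
    (h : Gen q (x ^ 2)) : Ureal N q ((q : ℂ) ^ N * x) = Ureal N q x := by
  have hqc : (q : ℂ) ≠ 0 := by exact_mod_cast hq0.ne'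
  have hx : x ≠ 0 := fun h0 => h.1 (by simp [h0])
  have hQ := normQ hN hq0 hq1
  have hQ0 : (q : ℂ) ^ (2 * N) ≠ 0 := pow_ne_zero _ hqc
  have hsq : ((q : ℂ) ^ N * x) ^ 2 = (q : ℂ) ^ (2 * N) * x ^ 2 := by ring
  have g1 : Gen q ((((q : ℂ) ^ N * x)⁻¹) ^ 2) := by
    rw [inv_pow, hsq]; exact (h.mul_pow hq0 _).inv hq0
  have e1 : (x⁻¹) ^ 2 = (q : ℂ) ^ (2 * N) * (((q : ℂ) ^ N * x)⁻¹) ^ 2 := by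
    rw [inv_pow _ 2, inv_pow _ 2, hsq]; field_simp
  have t1 := theta_shift _ _ hQ hQ0 h.1 h.ne_one
  have h2 := h.mul_pow hq0 2
  have t2 := theta_shift _ _ hQ hQ0 h2.1 h2.ne_one
  have t3 := theta_shift _ _ hQ hQ0 g1.1 g1.ne_one
  have g2 := g1.mul_pow hq0 2
  have t4 := theta_shift _ _ hQ hQ0 g2.1 g2.ne_one
  have n1 := theta_ne hN hq0 hq1 h
  have n2 := theta_ne hN hq0 hq1 g1
  have e2 : (q : ℂ) ^ 2 * ((q : ℂ) ^ N * x) ^ 2 = (q : ℂ) ^ (2 * N) * ((q : ℂ) ^ 2 * x ^ 2) := by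
    ring
  have e3 : (q : ℂ) ^ 2 * (x⁻¹) ^ 2
      = (q : ℂ) ^ (2 * N) * ((q : ℂ) ^ 2 * (((q : ℂ) ^ N * x)⁻¹) ^ 2) := by
    rw [e1]; ring
  unfold Ureal
  rw [e2, hsq, e3, e1, t1, t2, t3, t4]
  have hy := g1.1
  have hz : (((q : ℂ) ^ N * x)⁻¹) ≠ 0 := fun h0 => hy (by simp [h0])
  generalize (((q : ℂ) ^ N * x)⁻¹) = z at *
  field_simp

lemma U_zshift {N : ℕ} (hN : 2 ≤ N) {q : ℝ} (hq0 : 0 < q) (hq1 : q < 1) (k : ℤ) {x : ℂ}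
    (h : Gen q (x ^ 2)) : Ureal N q (((q : ℂ) ^ N) ^ k * x) = Ureal N q x := by
  have hqc : (q : ℂ) ≠ 0 := by exact_mod_cast hq0.ne'
  have hQ0 : (q : ℂ) ^ N ≠ 0 := pow_ne_zero _ hqc
  have nat : ∀ (j : ℕ) {x : ℂ}, Gen q (x ^ 2) →
      Ureal N q (((q : ℂ) ^ N) ^ j * x) = Ureal N q x := by
    intro j
    induction j with
    | zero => intro x _; simp
    | succ j ih =>
      intro x hx
      rw [pow_succ, mul_assoc, ih, U_shift hN hq0 hq1 hx]
      rw [mul_pow, ← pow_mul]; exact hx.mul_pow hq0 _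
  obtain ⟨j, rfl | rfl⟩ := k.eq_nat_or_neg
  · simpa using nat j h
  · have hg : Gen q ((((q : ℂ) ^ N) ^ (-(j : ℤ)) * x) ^ 2) := by
      have := h.mul hq0 (-(2 * N * j : ℕ) : ℚ)
      convert this using 1
      push_cast
      rw [Real.rpow_neg hq0.le, mul_pow]
      have : q ^ (2 * (N : ℝ) * j) = q ^ (2 * N * j) := by
        rw [← Real.rpow_natCast]; push_cast; rfl
      rw [this, zpow_neg, zpow_natCast]; push_cast
      congr 1
      rw [inv_pow]; congr 1; ring
    have := nat j hg
    rw [← this, zpow_neg, zpow_natCast, mul_inv_cancel_left₀ (pow_ne_zero _ hQ0)]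

lemma Fa_one {N : ℕ} (hN : 2 ≤ N) {q : ℝ} (hq0 : 0 < q) (hq1 : q < 1) {x : ℂ}
    (h : Gen q (x ^ 2)) (a : ℕ) (ha : 0 < a) (r : ℚ) (s : ℝ) (hs : s = q ^ (r : ℝ)) (k : ℤ)
    (hsk : s ^ a = (q ^ N) ^ k) :
    Fa N q (a : ℤ) x (s : ℂ) * Fa N q (-(a : ℤ)) x (s : ℂ) = 1 := by
  have hs0 : 0 < s := hs ▸ Real.rpow_pos_of_pos hq0 _
  have hsc : (s : ℂ) ≠ 0 := by exact_mod_cast hs0.ne'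
  have hskc : (s : ℂ) ^ a = ((q : ℂ) ^ N) ^ k := by exact_mod_cast hsk
  have hg : ∀ l : ℤ, Gen q (((s : ℂ) ^ l * x) ^ 2) := by
    intro l
    have := h.mul hq0 (r * (2 * l))
    convert this using 1
    rw [mul_pow]; push_cast
    congr 1
    rw [Real.rpow_mul hq0.le, ← hs]
    have : s ^ (2 * (l : ℝ)) = (s ^ l) ^ 2 := by
      rw [mul_comm, Real.rpow_mul hs0.le, Real.rpow_intCast]; norm_cast
    rw [this]; push_cast; rfl
  unfold Fa
  rw [if_pos (by exact_mod_cast ha), if_neg (by omega)]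
  rw [Int.toNat_natCast, Int.natAbs_neg, Int.natAbs_natCast, Finset.prod_inv_distrib]
  have hprod : ∏ l ∈ Finset.Icc 1 a, Ureal N q (((s : ℂ) ^ l)⁻¹ * x)
      = ∏ l ∈ Finset.range a, Ureal N q ((s : ℂ) ^ l * x) := by
    refine Finset.prod_nbij' (fun l => a - l) (fun l => a - l) ?_ ?_ ?_ ?_ ?_
    · intro l hl; simp at *; omega
    · intro l hl; simp at *; omega
    · intro l hl; simp at *; omega
    · intro l hl; simp at *; omega
    · intro l hl
      simp only [Finset.mem_Icc] at hl
      have hgl := hg (-(l : ℤ))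
      rw [zpow_neg, zpow_natCast] at hgl
      rw [← U_zshift hN hq0 hq1 k hgl, ← hskc, ← mul_assoc, pow_sub₀ _ hsc hl.2]
  rw [hprod]
  refine mul_inv_cancel₀ (Finset.prod_ne_zero_iff.2 fun l _ => U_ne hN hq0 hq1 ?_)
  simpa using hg (l : ℤ)

lemma s_zpow {N : ℕ} {q : ℝ} (hq0 : 0 < q) (m lam : ℤ) (hm : m ≠ 0) (s : ℝ)
    (hs : s = q ^ (-((N : ℝ) * (lam : ℝ)) / (m : ℝ))) : s ^ m = (q ^ N) ^ (-lam) := by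
  have hm' : (m : ℝ) ≠ 0 := by exact_mod_cast hm
  rw [hs, ← Real.rpow_intCast, ← Real.rpow_mul hq0.le, div_mul_cancel₀ _ hm',
    ← Real.rpow_natCast, ← Real.rpow_intCast, ← Real.rpow_mul hq0.le]
  push_cast; congr 1; ring

lemma Fa_int {N : ℕ} (hN : 2 ≤ N) {q : ℝ} (hq0 : 0 < q) (hq1 : q < 1) {x : ℂ}
    (h : Gen q (x ^ 2)) (m lam : ℤ) (hm : m ≠ 0) (s : ℝ)
    (hs : s = q ^ (-((N : ℝ) * (lam : ℝ)) / (m : ℝ))) :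
    Fa N q m x (s : ℂ) * Fa N q (-m) x (s : ℂ) = 1 := by
  have hz := s_zpow hq0 m lam hm s hs
  have hr : s = q ^ (((-((N : ℚ) * (lam : ℚ)) / (m : ℚ) : ℚ)) : ℝ) := by
    rw [hs]; push_cast; rfl
  obtain ⟨a, rfl | rfl⟩ := m.eq_nat_or_neg
  · exact Fa_one hN hq0 hq1 h a (by omega) _ s hr (-lam) (by simpa using hz)
  · rw [mul_comm, neg_neg]
    refine Fa_one hN hq0 hq1 h a (by omega) _ s hr lam ?_
    rw [zpow_neg, zpow_neg, inv_inj] at hz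
    simpa using hz

/-- Abelianity condition in the case `|m|, |n| > 1`: with `s = q^{-Nλ/m}` and
`s* = q^{-Nλ'/n}` (`λ + λ' = 1`, `λ, λ' ≠ 0`), the surface condition
`s^m (s*)^n = q^{-N}` holds, `(s*)² = s² q^{-2c}` with `c = N(λ'm - λn)/(nm)`,
and the structure function `𝒴_{m,n}(x) = ℱ_n(x;s*) ℱ_{-n}(x;s*) / (ℱ_m(x;s) ℱ_{-m}(x;s))`
equals `1`. -/
theorem abelianity_generic_case (N : ℕ) (hN : 2 ≤ N) (q : ℝ) (hq0 : 0 < q) (hq1 : q < 1)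
    (m n lam lam' : ℤ) (hm : 1 < |m|) (hn : 1 < |n|)
    (hlam : lam ≠ 0) (hlam' : lam' ≠ 0) (hsum : lam + lam' = 1)
    (s sstar c : ℝ)
    (hs : s = q ^ (-((N : ℝ) * (lam : ℝ)) / (m : ℝ)))
    (hsstar : sstar = q ^ (-((N : ℝ) * (lam' : ℝ)) / (n : ℝ)))
    (hc : c = (N : ℝ) * ((lam' : ℝ) * (m : ℝ) - (lam : ℝ) * (n : ℝ)) / ((n : ℝ) * (m : ℝ))) :
    s ^ m * sstar ^ n = q ^ (-(N : ℤ)) ∧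
    sstar ^ 2 = s ^ 2 * q ^ (-(2 * c)) ∧
    ∀ x : ℂ, x ≠ 0 → (∀ t : ℚ, x ^ 2 ≠ ((q ^ (t : ℝ) : ℝ) : ℂ)) →
      Fa N q n x (sstar : ℂ) * Fa N q (-n) x (sstar : ℂ) /
        (Fa N q m x (s : ℂ) * Fa N q (-m) x (s : ℂ)) = 1 := by
  have hm0 : m ≠ 0 := by rintro rfl; simp at hm
  have hn0 : n ≠ 0 := by rintro rfl; simp at hn
  refine ⟨?_, ?_, ?_⟩
  · rw [s_zpow hq0 m lam hm0 s hs, s_zpow hq0 n lam' hn0 sstar hsstar,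
      ← zpow_add₀ (pow_ne_zero _ hq0.ne')]
    have : -lam + -lam' = -1 := by omega
    rw [this]; simp
  · have hm' : (m : ℝ) ≠ 0 := by exact_mod_cast hm0
    have hn' : (n : ℝ) ≠ 0 := by exact_mod_cast hn0
    rw [hs, hsstar, hc, ← Real.rpow_natCast, ← Real.rpow_natCast, ← Real.rpow_mul hq0.le,
      ← Real.rpow_mul hq0.le, ← Real.rpow_add hq0]
    congr 1
    push_cast
    field_simp
    ring
  · intro x hx hxt
    have h : Gen q (x ^ 2) := ⟨pow_ne_zero _ hx, hxt⟩
    rw [Fa_int hN hq0 hq1 h n lam' hn0 sstar hsstar, Fa_int hN hq0 hq1 h m lam hm0 s hs, div_one]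

end
end

section
/- Let N ≥ 1 and 1 ≤ k ≤ N. For 1 ≤ i, j ≤ N define rational numbers α_{ij} by α_{ij} = 1/2 + (i−j)/N if i < j, α_{ii} = 0, and α_{ij} = −α_{ji} if i > j. Let j₁ < j₂ < ⋯ < j_k be indices in {1, …, N} and let σ be a permutation of {1, …, k} with ℓ(σ) inversions (its length). Then Σ_{1≤a<b≤k} α_{j_{σ(a)} j_{σ(b)}} + Σ_{a=1}^{k} (2a/N)(j_{σ(a)} − j_a) = −ℓ(σ) + Σ_{1≤a<b≤k} α_{j_a j_b}. -/
/-- the rational numbers `α_{ij}`: `α_{ij} = 1/2 + (i-j)/N` for `i < j`,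
`α_{ii} = 0`, `α_{ij} = -α_{ji}` for `i > j`. -/
def alph (N i j : ℕ) : ℚ :=
  if i < j then 1 / 2 + ((i : ℚ) - (j : ℚ)) / N
  else if i = j then 0
  else -(1 / 2 + ((j : ℚ) - (i : ℚ)) / N)

/-- the length (number of inversions) of a permutation of `Fin k`. -/
def permLength {k : ℕ} (σ : Equiv.Perm (Fin k)) : ℕ :=
  (Finset.univ.filter fun p : Fin k × Fin k => p.1 < p.2 ∧ σ p.2 < σ p.1).card

theorem pair_sum_aux {k : ℕ} (x : Fin k → ℚ) :
    ∑ p ∈ Finset.univ.filter (fun p : Fin k × Fin k => p.1 < p.2), (x p.1 - x p.2) =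
      ∑ a : Fin k, ((k : ℚ) - 1 - 2 * (a : ℕ)) * x a := by
  rw [Finset.sum_sub_distrib, Finset.sum_filter, Finset.sum_filter,
    Fintype.sum_prod_type, Fintype.sum_prod_type_right, ← Finset.sum_sub_distrib]
  refine Finset.sum_congr rfl fun a _ => ?_
  dsimp only
  rw [← Finset.sum_filter, ← Finset.sum_filter, Finset.sum_const, Finset.sum_const,
    Finset.filter_lt_eq_Ioi, Finset.filter_gt_eq_Iio, Fin.card_Ioi, Fin.card_Iio]
  have h : ((k - 1 - (a : ℕ) : ℕ) : ℚ) = (k : ℚ) - 1 - (a : ℕ) := by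
    have := a.isLt
    rw [Nat.cast_sub (by omega), Nat.cast_sub (by omega)]
    simp
  rw [nsmul_eq_mul, nsmul_eq_mul, h]
  ring

theorem alph_sum_aux (N k : ℕ) (j : Fin k → ℕ) (hmono : StrictMono j) (σ : Equiv.Perm (Fin k)) :
    ∑ p ∈ Finset.univ.filter (fun p : Fin k × Fin k => p.1 < p.2),
        alph N (j (σ p.1)) (j (σ p.2)) =
      (∑ p ∈ Finset.univ.filter (fun p : Fin k × Fin k => p.1 < p.2), (1 / 2 : ℚ)) -
        permLength σ +
      (∑ a : Fin k, ((k : ℚ) - 1 - 2 * (a : ℕ)) * (j (σ a) : ℚ)) / N := by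
  have hl : (permLength σ : ℚ) =
      ∑ p ∈ Finset.univ.filter (fun p : Fin k × Fin k => p.1 < p.2),
        if σ p.2 < σ p.1 then (1 : ℚ) else 0 := by
    rw [Finset.sum_boole, Finset.filter_filter]
    rfl
  rw [hl, ← pair_sum_aux (fun a => (j (σ a) : ℚ)), Finset.sum_div, ← Finset.sum_sub_distrib,
    ← Finset.sum_add_distrib]
  refine Finset.sum_congr rfl fun p hp => ?_
  have hp' : p.1 < p.2 := (Finset.mem_filter.mp hp).2
  unfold alph
  rcases lt_trichotomy (σ p.1) (σ p.2) with h | h | h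
  · rw [if_pos (hmono h), if_neg h.not_gt]
    ring
  · exact absurd (σ.injective h) hp'.ne
  · rw [if_neg (hmono h).not_gt, if_neg (hmono h).ne', if_pos h]
    ring

/-- `Σ_{a<b} α_{j_{σ(a)} j_{σ(b)}} + Σ_a (2a/N)(j_{σ(a)} - j_a)
  = -ℓ(σ) + Σ_{a<b} α_{j_a j_b}`. -/
theorem alpha_permutation_identity (N k : ℕ) (hN : 1 ≤ N) (hk : 1 ≤ k) (hkN : k ≤ N)
    (j : Fin k → ℕ) (hmono : StrictMono j) (hj : ∀ a, 1 ≤ j a ∧ j a ≤ N)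
    (σ : Equiv.Perm (Fin k)) :
    (∑ p ∈ Finset.univ.filter (fun p : Fin k × Fin k => p.1 < p.2),
        alph N (j (σ p.1)) (j (σ p.2))) +
      ∑ a : Fin k, 2 * ((a : ℕ) + 1 : ℚ) / N * ((j (σ a) : ℚ) - (j a : ℚ)) =
    -(permLength σ : ℚ) +
      ∑ p ∈ Finset.univ.filter (fun p : Fin k × Fin k => p.1 < p.2),
        alph N (j p.1) (j p.2) := by
  have h1 := alph_sum_aux N k j hmono σ
  have h2 := alph_sum_aux N k j hmono 1
  have h0 : permLength (1 : Equiv.Perm (Fin k)) = 0 := by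
    unfold permLength
    rw [Finset.card_eq_zero, Finset.filter_eq_empty_iff]
    rintro p _ ⟨h, h'⟩
    exact lt_asymm h h'
  rw [h0] at h2
  simp only [Equiv.Perm.one_apply, Nat.cast_zero, sub_zero] at h2
  rw [h1, h2]
  have hs : ∑ a, (j (σ a) : ℚ) = ∑ a, (j a : ℚ) := Equiv.sum_comp σ (fun a => (j a : ℚ))
  have key : (∑ a : Fin k, ((k : ℚ) - 1 - 2 * (a : ℕ)) * (j (σ a) : ℚ)) / N +
      ∑ a : Fin k, 2 * ((a : ℕ) + 1 : ℚ) / N * ((j (σ a) : ℚ) - (j a : ℚ)) -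
      (∑ a : Fin k, ((k : ℚ) - 1 - 2 * (a : ℕ)) * (j a : ℚ)) / N =
      ((k : ℚ) + 1) / N * (∑ a, (j (σ a) : ℚ) - ∑ a, (j a : ℚ)) := by
    rw [Finset.sum_div, Finset.sum_div, ← Finset.sum_add_distrib, ← Finset.sum_sub_distrib,
      ← Finset.sum_sub_distrib, Finset.mul_sum]
    refine Finset.sum_congr rfl fun a _ => ?_
    ring
  rw [hs, sub_self, mul_zero] at key
  linarith
end
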